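/- Gauss's formula: Let F be a finite field with q elements and let n be a positive integer. Then n times the number of monic irreducible polynomials of degree n over F equals the sum over all positive divisors d of n of μ(n/d)·q^d, where μ is the Möbius function. Equivalently, the number of monic irreducible polynomials of degree n over F is (1/n)·∑_{d∣n} μ(n/d)·q^d. -/

import Mathlib

open Polynomial

open UniqueFactorizationMonoid in
theorem gauss_sum_aux (F : Type*) [Field F] [Fintype F] (n : ℕ) (hn : 0 < n) :
    ∑ d ∈ n.divisors, d * Nat.card {p : F[X] // p.Monic ∧ Irreducible p ∧ p.natDegree = d} =
      Fintype.card F ^ n := by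
  classical
  obtain ⟨c, hc⟩ := CharP.exists F
  have hcard : Nat.card F = Fintype.card F := Nat.card_eq_fintype_card
  set P : F[X] := X ^ (Fintype.card F) ^ n - X with hP
  have hdeg : P.natDegree = Fintype.card F ^ n :=
    FiniteField.X_pow_card_pow_sub_X_natDegree_eq F hn.ne' Fintype.one_lt_card
  have hP0 : P ≠ 0 := FiniteField.X_pow_card_pow_sub_X_ne_zero F hn.ne' Fintype.one_lt_card
  have hsep : P.Separable := by
    apply galois_poly_separable c
    apply dvd_pow _ hn.ne'
    rw [← CharP.cast_eq_zero_iff F c]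
    exact FiniteField.cast_card_eq_zero F
  have hnodup : (normalizedFactors P).Nodup :=
    (squarefree_iff_nodup_normalizedFactors hP0).1 hsep.squarefree
  have hmem : ∀ p : F[X], p ∈ (normalizedFactors P).toFinset ↔
      p.Monic ∧ Irreducible p ∧ p.natDegree ∣ n := by
    intro p
    rw [Multiset.mem_toFinset, Polynomial.mem_normalizedFactors_iff hP0]
    constructor
    · rintro ⟨h1, h2, h3⟩
      exact ⟨h2, h1, h1.natDegree_dvd_iff_dvd_X_pow_card_pow_sub_X.2 (by rwa [hcard])⟩
    · rintro ⟨h1, h2, h3⟩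
      refine ⟨h2, h1, ?_⟩
      have := h2.natDegree_dvd_iff_dvd_X_pow_card_pow_sub_X.1 h3
      rwa [hcard] at this
  have hsum : P.natDegree = ∑ p ∈ (normalizedFactors P).toFinset, p.natDegree := by
    have h1 := natDegree_eq_of_degree_eq
      (degree_eq_degree_of_associated (prod_normalizedFactors hP0))
    rw [← h1, natDegree_multiset_prod _ (zero_notMem_normalizedFactors P), Finset.sum,
      Multiset.toFinset_val, hnodup.dedup]
  rw [← hdeg, hsum, ← Finset.sum_fiberwise_of_maps_to (t := n.divisors) (g := natDegree)
    (fun p hp => Nat.mem_divisors.2 ⟨((hmem p).1 hp).2.2, hn.ne'⟩)]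
  refine Finset.sum_congr rfl fun d hd => ?_
  rw [Finset.sum_congr rfl (g := fun _ => d) (fun p hp => (Finset.mem_filter.1 hp).2),
    Finset.sum_const, smul_eq_mul, mul_comm]
  congr 1
  rw [Nat.subtype_card]
  intro p
  rw [Finset.mem_filter, hmem]
  constructor
  · rintro ⟨⟨h1, h2, h3⟩, h4⟩
    exact ⟨h1, h2, h4⟩
  · rintro ⟨h1, h2, h4⟩
    exact ⟨⟨h1, h2, h4 ▸ Nat.dvd_of_mem_divisors hd⟩, h4⟩

/-- Gauss's formula: `n` times the number of monic irreducible polynomials of degree `n`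
over a finite field `F` with `q` elements equals `∑_{d ∣ n} μ(n/d) * q^d`. -/
theorem gauss_formula (F : Type*) [Field F] [Fintype F] (q : ℕ) (hq : q = Fintype.card F)
    (n : ℕ) (hn : 0 < n) :
    (n : ℤ) * Nat.card {p : F[X] // p.Monic ∧ Irreducible p ∧ p.natDegree = n} =
      ∑ d ∈ n.divisors, (ArithmeticFunction.moebius (n / d)) * (q : ℤ) ^ d := by
  have key := (ArithmeticFunction.sum_eq_iff_sum_mul_moebius_eq
    (f := fun n : ℕ => (n : ℤ) *
      (Nat.card {p : F[X] // p.Monic ∧ Irreducible p ∧ p.natDegree = n} : ℤ))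
    (g := fun n => (q : ℤ) ^ n)).1 (by
      intro m hm
      rw [hq]
      exact_mod_cast gauss_sum_aux F m hm) n hn
  rw [← key]
  exact Nat.sum_divisorsAntidiagonal'
    (fun a b => (ArithmeticFunction.moebius a : ℤ) * (q : ℤ) ^ b)
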